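/- Let χ ∈ V and let v : ℝ → V be differentiable on [0,T] with v'(t) + A v(t) = 0 for t ∈ [0,T] and v(T) − v(0) = χ. Suppose v̂ : ℝ → V is differentiable on [0,T] with v̂'(t) + A v̂(t) = 0 for t ∈ [0,T], and define the next iterate ṽ : ℝ → V as any differentiable solution of ṽ'(t) + A ṽ(t) = 0 on [0,T] with initial condition ṽ(0) = v̂(T) − χ. Then ‖ṽ(0) − v(0)‖ ≤ exp(−δ T) · ‖v̂(0) − v(0)‖. -/

import Mathlib

open RealInnerProductSpace

/-- One step of the iterative refinement of the initial condition for the nonlocal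
problem `v' + A v = 0`, `v(T) - v(0) = χ` contracts with factor `exp(-δ T)`. -/
theorem stmt_1 {V : Type*} [NormedAddCommGroup V] [InnerProductSpace ℝ V]
    [FiniteDimensional ℝ V]
    (A : V →L[ℝ] V) (hA : ∀ x y : V, ⟪A x, y⟫ = ⟪x, A y⟫)
    (δ : ℝ) (hδ : 0 < δ) (hcoer : ∀ v : V, δ * ‖v‖ ^ 2 ≤ ⟪A v, v⟫)
    (T : ℝ) (hT : 0 < T)
    (χ : V) (v vhat vtil : ℝ → V)
    (hvdiff : ∀ t ∈ Set.Icc (0 : ℝ) T, DifferentiableAt ℝ v t)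
    (hveq : ∀ t ∈ Set.Icc (0 : ℝ) T, deriv v t + A (v t) = 0)
    (hvnl : v T - v 0 = χ)
    (hhatdiff : ∀ t ∈ Set.Icc (0 : ℝ) T, DifferentiableAt ℝ vhat t)
    (hhateq : ∀ t ∈ Set.Icc (0 : ℝ) T, deriv vhat t + A (vhat t) = 0)
    (htildiff : ∀ t ∈ Set.Icc (0 : ℝ) T, DifferentiableAt ℝ vtil t)
    (htileq : ∀ t ∈ Set.Icc (0 : ℝ) T, deriv vtil t + A (vtil t) = 0)
    (htil0 : vtil 0 = vhat T - χ) :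
    ‖vtil 0 - v 0‖ ≤ Real.exp (-δ * T) * ‖vhat 0 - v 0‖ := by
  have hw : ∀ t ∈ Set.Icc (0 : ℝ) T,
      HasDerivAt (fun t => vhat t - v t) (-(A (vhat t - v t))) t := by
    intro t ht
    have h1 := (hhatdiff t ht).hasDerivAt.sub (hvdiff t ht).hasDerivAt
    rw [eq_neg_of_add_eq_zero_left (hhateq t ht), eq_neg_of_add_eq_zero_left (hveq t ht)] at h1
    have h0 : -(A (vhat t - v t)) = -A (vhat t) - -A (v t) := by
      rw [map_sub]
      abel
    rw [h0]
    exact h1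
  have hg : ∀ t ∈ Set.Icc (0 : ℝ) T,
      HasDerivAt (fun t => Real.exp (2 * δ * t) * ‖vhat t - v t‖ ^ 2)
        (Real.exp (2 * δ * t) * (2 * δ) * ‖vhat t - v t‖ ^ 2 +
          Real.exp (2 * δ * t) * (2 * ⟪vhat t - v t, -(A (vhat t - v t))⟫)) t := by
    intro t ht
    have he : HasDerivAt (fun t : ℝ => Real.exp (2 * δ * t))
        (Real.exp (2 * δ * t) * (2 * δ)) t := by
      have h2 : HasDerivAt (fun t : ℝ => 2 * δ * t) (2 * δ) t := by
        simpa using (hasDerivAt_id t).const_mul (2 * δ)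
      exact h2.exp
    exact he.mul (hw t ht).norm_sq
  have hanti := antitoneOn_of_deriv_nonpos (convex_Icc (0 : ℝ) T)
    (f := fun t => Real.exp (2 * δ * t) * ‖vhat t - v t‖ ^ 2)
    (fun t ht => (hg t ht).continuousAt.continuousWithinAt)
    (fun t ht => (hg t (interior_subset ht)).differentiableAt.differentiableWithinAt)
    (by
      intro t ht
      rw [(hg t (interior_subset ht)).deriv, inner_neg_right, real_inner_comm]
      have h3 := mul_le_mul_of_nonneg_left (hcoer (vhat t - v t))
        (Real.exp_pos (2 * δ * t)).le
      linarith)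
  have h4 := hanti (Set.left_mem_Icc.2 hT.le) (Set.right_mem_Icc.2 hT.le) hT.le
  simp only [mul_zero, Real.exp_zero, one_mul] at h4
  have h5 : vtil 0 - v 0 = vhat T - v T := by
    rw [htil0, ← hvnl]
    abel
  have h6 : Real.exp (2 * δ * T) = Real.exp (δ * T) ^ 2 := by
    rw [← Real.exp_nat_mul]
    congr 1
    push_cast
    ring
  rw [h6, ← mul_pow] at h4
  rw [h5, neg_mul, Real.exp_neg, inv_mul_eq_div, le_div_iff₀ (Real.exp_pos _), mul_comm]
  exact (pow_le_pow_iff_left₀ (by positivity) (norm_nonneg _) two_ne_zero).1 h4
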